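/- Let E₁, E₂ be real finite-dimensional inner product spaces, 0 < μ ≤ L, and κ := L/μ. Let ĝ : E₁ × E₂ → ℝ be such that for every x the function ĝ(x,·) is differentiable and μ-strongly convex with unique minimizer y*(x), y ↦ ∇_y ĝ(x,y) is L-Lipschitz, and the minimizer map x ↦ y*(x) is κ-Lipschitz. Let 0 < α ≤ 1/L and K ≥ 1, and let (x^k)_{k=0}^{K} be any sequence in E₁ and (y^k)_{k=0}^{K} a sequence in E₂ with y^{k+1} = y^k − α ∇_y ĝ(x^k, y^k) for k = 0,…,K−1. Then Σ_{k=0}^{K−1} ‖y*(x^k) − y^k‖² ≤ (2/(αμ))·‖y*(x⁰) − y⁰‖² + (1 + 2/(αμ))·(2κ²/(αμ))·Σ_{k=0}^{K−1} ‖x^{k+1} − x^k‖². -/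

import Mathlib

open Filter Topology in
lemma aux_strong {E : Type*} [NormedAddCommGroup E] [InnerProductSpace ℝ E] [CompleteSpace E]
    (μ : ℝ) (f : E → ℝ) (v y z : E) (hf : HasGradientAt f v y)
    (hsc : StrongConvexOn Set.univ μ f) :
    f y + inner ℝ v (z - y) + μ / 2 * ‖y - z‖ ^ 2 ≤ f z := by
  have hline : HasDerivAt (fun t : ℝ => y + t • (z - y)) (z - y) 0 := by
    simpa using ((hasDerivAt_id (0 : ℝ)).smul_const (z - y)).const_add y
  have hd : HasDerivAt (fun t : ℝ => f (y + t • (z - y))) (inner ℝ v (z - y)) 0 := by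
    have h1 : HasFDerivAt f (InnerProductSpace.toDual ℝ E v) (y + (0 : ℝ) • (z - y)) := by
      simpa using hf.hasFDerivAt
    exact h1.comp_hasDerivAt (0 : ℝ) hline
  have h2 := hd.tendsto_slope_zero_right
  have h3 : Tendsto (fun t : ℝ => f z - f y - (1 - t) * (μ / 2 * ‖y - z‖ ^ 2)) (𝓝[>] 0)
      (𝓝 (f z - f y - (1 - 0) * (μ / 2 * ‖y - z‖ ^ 2))) := by
    apply Tendsto.mono_left _ nhdsWithin_le_nhds
    exact Continuous.tendsto (by fun_prop) 0
  have h4 := le_of_tendsto_of_tendsto h2 h3 (by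
    filter_upwards [Ioo_mem_nhdsGT (zero_lt_one : (0:ℝ) < 1)] with t ht
    have h5 := hsc.2 (Set.mem_univ y) (Set.mem_univ z) (sub_nonneg.2 ht.2.le) ht.1.le (by ring)
    have h6 : (1 - t) • y + t • z = y + t • (z - y) := by module
    rw [h6] at h5
    simp only [zero_add, zero_smul, add_zero, smul_eq_mul] at h5 ⊢
    rw [inv_mul_le_iff₀ ht.1]
    nlinarith)
  linarith

lemma aux_descent {E : Type*} [NormedAddCommGroup E] [InnerProductSpace ℝ E] [CompleteSpace E]
    (L : ℝ) (hL : 0 < L) (f : E → ℝ) (G : E → E) (hf : ∀ y, HasGradientAt f (G y) y)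
    (hlip : ∀ y y', ‖G y - G y'‖ ≤ L * ‖y - y'‖) (y : E) :
    f (y - (1 / L) • G y) ≤ f y - 1 / (2 * L) * ‖G y‖ ^ 2 := by
  set v := G y with hv
  have hd : ∀ t : ℝ, HasDerivAt (fun t : ℝ => f (y - t • v) + (t * ‖v‖ ^ 2 - t ^ 2 * (L / 2 * ‖v‖ ^ 2)))
      (inner ℝ (G (y - t • v)) (-v) + (1 * ‖v‖ ^ 2 - (2 * t) * (L / 2 * ‖v‖ ^ 2))) t := by
    intro t
    have hline : HasDerivAt (fun t : ℝ => y - t • v) (-v) t := by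
      simpa using ((hasDerivAt_id t).smul_const v).const_sub y
    have h1 : HasDerivAt (fun t : ℝ => f (y - t • v)) (inner ℝ (G (y - t • v)) (-v)) t := by
      exact (hf (y - t • v)).hasFDerivAt.comp_hasDerivAt t hline
    refine h1.add (HasDerivAt.sub ?_ ?_)
    · exact (hasDerivAt_id t).mul_const _
    · simpa using (hasDerivAt_pow 2 t).mul_const (L / 2 * ‖v‖ ^ 2)
  have hanti := antitoneOn_of_deriv_nonpos (convex_Ici (0 : ℝ))
    (fun t _ => (hd t).continuousAt.continuousWithinAt)
    (fun t _ => (hd t).differentiableAt.differentiableWithinAt)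
    (by
      intro t ht
      rw [interior_Ici] at ht
      have ht : 0 < t := ht
      rw [(hd t).deriv]
      have h1 := real_inner_le_norm (v - G (y - t • v)) v
      have h2 := hlip y (y - t • v)
      rw [sub_sub_cancel, norm_smul, Real.norm_of_nonneg ht.le] at h2
      rw [inner_sub_left, real_inner_self_eq_norm_sq] at h1
      rw [inner_neg_right]
      have h3 := mul_le_mul_of_nonneg_right h2 (norm_nonneg v)
      rw [← hv] at h3
      nlinarith)
  have h := hanti (Set.mem_Ici.2 le_rfl) (Set.mem_Ici.2 (by positivity : 0 ≤ 1 / L)) (by positivity)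
  simp only [zero_smul, sub_zero] at h
  have e : 1 / L * ‖v‖ ^ 2 - (1 / L) ^ 2 * (L / 2 * ‖v‖ ^ 2) = 1 / (2 * L) * ‖v‖ ^ 2 := by
    field_simp; ring
  rw [e] at h
  linarith

lemma aux_contract {E : Type*} [NormedAddCommGroup E] [InnerProductSpace ℝ E] [CompleteSpace E]
    (μ L α : ℝ) (hL : 0 < L) (hα : 0 < α) (hα' : α ≤ 1 / L)
    (f : E → ℝ) (G : E → E) (hf : ∀ y, HasGradientAt f (G y) y)
    (hsc : StrongConvexOn Set.univ μ f)
    (hlip : ∀ y y', ‖G y - G y'‖ ≤ L * ‖y - y'‖) (s y : E) (hmin : ∀ y, f s ≤ f y) :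
    ‖s - (y - α • G y)‖ ^ 2 ≤ (1 - α * μ) * ‖s - y‖ ^ 2 := by
  have h1 := aux_strong μ f (G y) y s (hf y) hsc
  have h2 := (hmin _).trans (aux_descent L hL f G hf hlip y)
  have e : s - (y - α • G y) = (s - y) + α • G y := by abel
  rw [e, norm_add_sq_real, inner_smul_right, norm_smul, Real.norm_of_nonneg hα.le,
    real_inner_comm]
  rw [norm_sub_rev y s] at h1
  have h3 : α * (α * ‖G y‖ ^ 2) ≤ α * (1 / L * ‖G y‖ ^ 2) := by gcongr
  have e2 : 1 / (2 * L) * ‖G y‖ ^ 2 = (1 / L * ‖G y‖ ^ 2) / 2 := by field_simp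
  rw [e2] at h2
  have h4 := mul_le_mul_of_nonneg_left (add_le_add h1 h2) hα.le
  nlinarith

lemma aux_young {E : Type*} [NormedAddCommGroup E] [InnerProductSpace ℝ E]
    (a b : E) (c : ℝ) (hc : 0 < c) :
    ‖a + b‖ ^ 2 ≤ (1 + c / 2) * ‖a‖ ^ 2 + (1 + 2 / c) * ‖b‖ ^ 2 := by
  have h1 : ‖a + b‖ ^ 2 ≤ (‖a‖ + ‖b‖) ^ 2 := by gcongr; exact norm_add_le a b
  have h2 : c / 2 * ‖a‖ ^ 2 + 2 / c * ‖b‖ ^ 2 - 2 * ‖a‖ * ‖b‖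
      = (c * ‖a‖ - 2 * ‖b‖) ^ 2 / (2 * c) := by field_simp; ring
  have h3 : 0 ≤ (c * ‖a‖ - 2 * ‖b‖) ^ 2 / (2 * c) := by positivity
  nlinarith


/-- Inner-loop tracking bound (first inequality of Lemma B.5): for gradient descent
`y^{k+1} = y^k − α∇_y ĝ(x^k, y^k)` on a `μ`-strongly convex, `L`-smooth inner objective
with `κ`-Lipschitz minimizer map `y*`,
`Σ_{k<K} ‖y*(x^k) − y^k‖² ≤ (2/(αμ))‖y*(x⁰) − y⁰‖²
  + (1 + 2/(αμ))(2κ²/(αμ)) Σ_{k<K} ‖x^{k+1} − x^k‖²`. -/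
theorem inner_loop_tracking_sum {E₁ E₂ : Type*}
    [NormedAddCommGroup E₁] [InnerProductSpace ℝ E₁] [FiniteDimensional ℝ E₁]
    [NormedAddCommGroup E₂] [InnerProductSpace ℝ E₂] [FiniteDimensional ℝ E₂]
    (μ L : ℝ) (hμ : 0 < μ) (hμL : μ ≤ L)
    (κ : ℝ) (hκ : κ = L / μ)
    (g : E₁ → E₂ → ℝ) (gy : E₁ → E₂ → E₂) (ys : E₁ → E₂)
    (hgrad : ∀ (x : E₁) (y : E₂), HasGradientAt (g x) (gy x y) y)
    (hsc : ∀ x : E₁, StrongConvexOn Set.univ μ (g x))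
    (hmin : ∀ (x : E₁) (y : E₂), g x (ys x) ≤ g x y)
    (hgylip : ∀ (x : E₁) (y y' : E₂), ‖gy x y - gy x y'‖ ≤ L * ‖y - y'‖)
    (hyslip : ∀ x x' : E₁, ‖ys x - ys x'‖ ≤ κ * ‖x - x'‖)
    (α : ℝ) (hα : 0 < α) (hα' : α ≤ 1 / L)
    (K : ℕ) (hK : 1 ≤ K)
    (x : ℕ → E₁) (y : ℕ → E₂)
    (hy : ∀ k < K, y (k + 1) = y k - α • gy (x k) (y k)) :
    ∑ k ∈ Finset.range K, ‖ys (x k) - y k‖ ^ 2 ≤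
      (2 / (α * μ)) * ‖ys (x 0) - y 0‖ ^ 2 +
      (1 + 2 / (α * μ)) * (2 * κ ^ 2 / (α * μ)) *
        ∑ k ∈ Finset.range K, ‖x (k + 1) - x k‖ ^ 2 := by


  have hL : 0 < L := hμ.trans_le hμL
  set c := α * μ with hcdef
  have hc : 0 < c := mul_pos hα hμ
  have step : ∀ k < K, ‖ys (x (k + 1)) - y (k + 1)‖ ^ 2 ≤
      (1 - c / 2) * ‖ys (x k) - y k‖ ^ 2 + (1 + 2 / c) * κ ^ 2 * ‖x (k + 1) - x k‖ ^ 2 := by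
    intro k hk
    have h1 := aux_contract μ L α hL hα hα' (g (x k)) (gy (x k)) (hgrad _) (hsc _) (hgylip _)
      (ys (x k)) (y k) (hmin _)
    rw [← hy k hk, ← hcdef] at h1
    have h2 := aux_young (ys (x k) - y (k + 1)) (ys (x (k + 1)) - ys (x k)) c hc
    have e : ys (x k) - y (k + 1) + (ys (x (k + 1)) - ys (x k)) = ys (x (k + 1)) - y (k + 1) := by
      abel
    rw [e] at h2
    have h3 : ‖ys (x (k + 1)) - ys (x k)‖ ^ 2 ≤ (κ * ‖x (k + 1) - x k‖) ^ 2 := by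
      gcongr; exact hyslip _ _
    have h4 : (1 + 2 / c) * ‖ys (x (k + 1)) - ys (x k)‖ ^ 2 ≤
      (1 + 2 / c) * (κ * ‖x (k + 1) - x k‖) ^ 2 := by gcongr
    have h5 := mul_le_mul_of_nonneg_left h1 (by positivity : 0 ≤ 1 + c / 2)
    have h6 : 0 ≤ c ^ 2 * ‖ys (x k) - y k‖ ^ 2 := by positivity
    nlinarith
  have key : ∀ n ≤ K, c / 2 * ∑ k ∈ Finset.range n, ‖ys (x k) - y k‖ ^ 2 + ‖ys (x n) - y n‖ ^ 2 ≤
      ‖ys (x 0) - y 0‖ ^ 2 +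
        (1 + 2 / c) * κ ^ 2 * ∑ k ∈ Finset.range n, ‖x (k + 1) - x k‖ ^ 2 := by
    intro n
    induction n with
    | zero => intro _; simp
    | succ n ih =>
      intro hn
      have h1 := ih (by omega)
      have h2 := step n (by omega)
      rw [Finset.sum_range_succ, Finset.sum_range_succ]
      linarith
  have h := key K le_rfl
  have h0 : 0 ≤ ‖ys (x K) - y K‖ ^ 2 := by positivity
  have h' := mul_le_mul_of_nonneg_left ((le_add_of_nonneg_right h0).trans h)
    (by positivity : 0 ≤ 2 / c)
  have e1 : 2 / c * (c / 2 * ∑ k ∈ Finset.range K, ‖ys (x k) - y k‖ ^ 2) =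
      ∑ k ∈ Finset.range K, ‖ys (x k) - y k‖ ^ 2 := by field_simp
  rw [e1] at h'
  refine h'.trans (le_of_eq ?_)
  ring
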